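/- Existence and uniqueness for analytic forcing functions in the model problem: for every function f that is complex-analytic on an open set containing the real interval [0,1], there exists a unique function u, complex-analytic on an open set containing [0,1], such that u(0) = 0, u(1) = 0, and u''(x) + (1/x)·u'(x) − (1/x²)·u(x) = f(x) for all x ∈ (0,1]. -/

import Mathlib

open Set

open Filter Topology in
/-- A real-analytic function germ is the restriction of a complex-analytic one. -/
lemma AnalyticAt.exists_analyticAt_complex {f : ℝ → ℂ} {x : ℝ} (hf : AnalyticAt ℝ f x) :
    ∃ g : ℂ → ℂ, AnalyticAt ℂ g x ∧ ∀ᶠ y : ℝ in 𝓝 x, g y = f y := by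
  obtain ⟨p, hp⟩ := hf
  let q : FormalMultilinearSeries ℂ ℂ ℂ := fun n ↦
    ContinuousMultilinearMap.mkPiRing ℂ (Fin n) (p.coeff n)
  have hq : 0 < q.radius := hp.radius_pos.trans_le <|
    FormalMultilinearSeries.radius_le_of_le fun n ↦ by
      simp [q, ContinuousMultilinearMap.norm_mkPiRing,
        FormalMultilinearSeries.norm_apply_eq_norm_coef]
  have hqb := q.hasFPowerSeriesOnBall hq
  refine ⟨fun z ↦ q.sum (z - x), ?_, ?_⟩
  · refine AnalyticAt.fun_comp (g := q.sum) (f := fun z : ℂ ↦ z - x) ?_ (by fun_prop)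
    simpa using hqb.analyticAt
  · have hmem : ∀ᶠ y : ℝ in 𝓝 x, ((y : ℂ) - x) ∈ Metric.eball (0 : ℂ) q.radius := by
      have hc : ContinuousAt (fun y : ℝ ↦ (y : ℂ) - x) x := by fun_prop
      exact hc.eventually_mem (by simpa using Metric.eball_mem_nhds (0 : ℂ) hq)
    have hsum := hasFPowerSeriesAt_iff.1 hp
    have ht : Tendsto (fun y : ℝ ↦ y - x) (𝓝 x) (𝓝 0) := by
      have hc : ContinuousAt (fun y : ℝ ↦ y - x) x := by fun_prop
      simpa [ContinuousAt] using hc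
    filter_upwards [hmem, ht.eventually hsum] with y hy hys
    refine (q.hasSum hy).unique ?_
    simpa [q] using hys

open Filter Topology in
/-- A function whose derivative is analytic is analytic. -/
lemma AnalyticAt.of_eventually_hasDerivAt {f F : ℝ → ℂ} {x : ℝ} (hf : AnalyticAt ℝ f x)
    (hF : ∀ᶠ y in 𝓝 x, HasDerivAt F (f y) y) : AnalyticAt ℝ F x := by
  obtain ⟨g, hg, hgf⟩ := hf.exists_analyticAt_complex
  obtain ⟨r, hr, hgr⟩ := Metric.eventually_nhds_iff_ball.1 hg.eventually_analyticAt
  obtain ⟨H, hH⟩ := DifferentiableOn.isExactOn_ball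
    (fun z hz ↦ (hgr z hz).differentiableAt.differentiableWithinAt :
      DifferentiableOn ℂ g (Metric.ball (x : ℂ) r))
  have hHan : AnalyticAt ℂ H x := DifferentiableOn.analyticAt
    (fun z hz ↦ (hH z hz).differentiableAt.differentiableWithinAt) (Metric.ball_mem_nhds _ hr)
  have hHx : AnalyticAt ℝ (fun y : ℝ ↦ H y) x :=
    AnalyticAt.fun_comp (g := H) (f := fun y : ℝ ↦ (y : ℂ)) hHan.restrictScalars
      (Complex.ofRealCLM.analyticAt x)
  have hmem : ∀ᶠ y : ℝ in 𝓝 x, (y : ℂ) ∈ Metric.ball (x : ℂ) r :=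
    Complex.continuous_ofReal.continuousAt.eventually_mem (Metric.ball_mem_nhds _ hr)
  have hd : ∀ᶠ y in 𝓝 x, HasDerivAt (fun y : ℝ ↦ F y - H y) 0 y := by
    filter_upwards [hF, hgf, hmem] with y h1 h2 h3
    exact (h1.sub (hH y h3).comp_ofReal).congr_deriv (by simp [h2])
  obtain ⟨s, hs, hds⟩ := Metric.eventually_nhds_iff_ball.1 hd
  have hconst : ∀ᶠ y : ℝ in 𝓝 x, H y + (F x - H x) = F y := by
    filter_upwards [Metric.ball_mem_nhds x hs] with y hy
    have := Metric.isOpen_ball.is_const_of_deriv_eq_zero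
      (convex_ball x s).isPreconnected
      (fun z hz ↦ (hds z hz).differentiableAt.differentiableWithinAt)
      (fun z hz ↦ (hds z hz).deriv) hy (Metric.mem_ball_self hs)
    rw [← this]; ring
  exact (hHx.add analyticAt_const).congr hconst

/-- On an open interval, an analytic function has an analytic primitive vanishing at a given
point. -/
lemma AnalyticOnNhd.exists_primitive {f : ℝ → ℂ} {U : Set ℝ} (hf : AnalyticOnNhd ℝ f U)
    (hU : IsOpen U) (hc : U.OrdConnected) {a : ℝ} (ha : a ∈ U) :
    ∃ F : ℝ → ℂ, AnalyticOnNhd ℝ F U ∧ F a = 0 ∧ ∀ x ∈ U, HasDerivAt F (f x) x := by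
  have hd : ∀ x ∈ U, HasDerivAt (fun x ↦ ∫ t in a..x, f t) (f x) x := fun x hx ↦
    intervalIntegral.integral_hasDerivAt_right
      (hf.continuousOn.mono (hc.uIcc_subset ha hx)).intervalIntegrable
      (hf.continuousOn.stronglyMeasurableAtFilter hU x hx) (hf x hx).continuousAt
  exact ⟨_, fun x hx ↦ (hf x hx).of_eventually_hasDerivAt
    (Filter.mem_of_superset (hU.mem_nhds hx) hd), intervalIntegral.integral_same, hd⟩

/-- An open set containing a preconnected set `s` on which `f` is analytic can be shrunk to an
open interval. -/
lemma AnalyticOnNhd.exists_isOpen_ordConnected {f : ℝ → ℂ} {s : Set ℝ}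
    (hf : AnalyticOnNhd ℝ f s) (hs : IsPreconnected s) {a : ℝ} (ha : a ∈ s) :
    ∃ U, IsOpen U ∧ U.OrdConnected ∧ s ⊆ U ∧ AnalyticOnNhd ℝ f U :=
  ⟨connectedComponentIn {x | AnalyticAt ℝ f x} a, (isOpen_analyticAt ℝ f).connectedComponentIn,
    isPreconnected_connectedComponentIn.ordConnected, hs.subset_connectedComponentIn ha hf,
    connectedComponentIn_subset _ _⟩

open Filter Topology in
/-- Existence part of the model problem. -/
lemma exists_analytic_solution {f : ℝ → ℂ} (hf : AnalyticOnNhd ℝ f (Icc (0 : ℝ) 1)) :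
    ∃ u : ℝ → ℂ, AnalyticOnNhd ℝ u (Icc (0 : ℝ) 1) ∧ u 0 = 0 ∧ u 1 = 0 ∧
      ∀ x ∈ Ioc (0 : ℝ) 1,
        deriv (deriv u) x + (1 / (x : ℂ)) * deriv u x - (1 / (x : ℂ) ^ 2) * u x = f x := by
  have h0 : (0 : ℝ) ∈ Icc (0 : ℝ) 1 := by simp
  obtain ⟨U, hU, hUc, hIU, hfU⟩ := hf.exists_isOpen_ordConnected isPreconnected_Icc h0
  obtain ⟨F, hF, -, hFd⟩ := hfU.exists_primitive hU hUc (hIU h0)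
  have hid : ∀ x : ℝ, AnalyticAt ℝ (fun x : ℝ ↦ (x : ℂ)) x := Complex.ofRealCLM.analyticAt
  have hidd : ∀ x : ℝ, HasDerivAt (fun x : ℝ ↦ (x : ℂ)) 1 x := fun x ↦
    Complex.ofRealCLM.hasDerivAt
  obtain ⟨G, hG, hG0, hGd⟩ := AnalyticOnNhd.exists_primitive (f := fun x ↦ (x : ℂ) * F x)
    (fun x hx ↦ (hid x).mul (hF x hx)) hU hUc (hIU h0)
  have hval : ∀ x : ℝ, x ≠ 0 → dslope G 0 x - G 1 * x = G x / x - G 1 * x := by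
    intro x hx
    rw [dslope_of_ne _ hx, slope_def_module]
    simp [hG0, div_eq_inv_mul]
  have hne : ∀ x : ℝ, x ≠ 0 → ∀ᶠ y in 𝓝 x,
      dslope G 0 y - G 1 * y = G y / y - G 1 * y := fun x hx ↦
    mem_of_superset (isOpen_ne.mem_nhds hx) hval
  refine ⟨fun x ↦ dslope G 0 x - G 1 * x, ?_, ?_, ?_, ?_⟩
  · intro x hx
    rcases eq_or_ne x 0 with rfl | hx0
    · obtain ⟨p, hp⟩ := hG 0 (hIU h0)
      exact (HasFPowerSeriesAt.has_fpower_series_dslope_fslope hp).analyticAt.sub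
        (analyticAt_const.mul (hid 0))
    · refine AnalyticAt.congr ?_ (EventuallyEq.symm (hne x hx0))
      exact ((hG x (hIU hx)).div (hid x) (by simpa using hx0)).sub (analyticAt_const.mul (hid x))
  · simp [(hGd 0 (hIU h0)).deriv]
  · exact (hval 1 one_ne_zero).trans (by simp)
  · intro x hx
    have hxU : x ∈ U := hIU (Ioc_subset_Icc_self hx)
    have hx0 : x ≠ 0 := hx.1.ne'
    have hxc : (x : ℂ) ≠ 0 := by exact_mod_cast hx0
    have hd1 : ∀ y ∈ U, y ≠ 0 → HasDerivAt (fun x : ℝ ↦ dslope G 0 x - G 1 * x)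
        (F y - G y / (y : ℂ) ^ 2 - G 1) y := by
      intro y hy hy0
      have hyc : (y : ℂ) ≠ 0 := by exact_mod_cast hy0
      have h := ((hGd y hy).div (hidd y) hyc).sub ((hidd y).const_mul (G 1))
      refine (h.congr_of_eventuallyEq (hne y hy0)).congr_deriv ?_
      field_simp
    have hd2 : HasDerivAt (deriv fun x : ℝ ↦ dslope G 0 x - G 1 * x)
        (f x - F x / x + 2 * G x / (x : ℂ) ^ 3) x := by
      have h := ((hFd x hxU).sub ((hGd x hxU).div ((hidd x).pow 2)
        (pow_ne_zero 2 hxc))).sub_const (G 1)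
      refine (h.congr_of_eventuallyEq ?_).congr_deriv ?_
      · filter_upwards [hU.mem_nhds hxU, isOpen_ne.mem_nhds hx0] with y hy hy0
        simpa using (hd1 y hy hy0).deriv
      · simp
        field_simp
        ring
    rw [hd2.deriv, (hd1 x hxU hx0).deriv]
    simp only [hval x hx0]
    field_simp
    ring

/-- The homogeneous model problem has only the trivial solution. -/
lemma eqOn_zero_of_homogeneous {w : ℝ → ℂ} (hw : AnalyticOnNhd ℝ w (Icc (0 : ℝ) 1))
    (hw0 : w 0 = 0) (hw1 : w 1 = 0) (hode : ∀ x ∈ Ioc (0 : ℝ) 1,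
      deriv (deriv w) x + (1 / (x : ℂ)) * deriv w x - (1 / (x : ℂ) ^ 2) * w x = 0) :
    EqOn w 0 (Icc (0 : ℝ) 1) := by
  have hidd : ∀ x : ℝ, HasDerivAt (fun x : ℝ ↦ (x : ℂ)) 1 x := fun x ↦
    Complex.ofRealCLM.hasDerivAt
  have hd : ∀ x ∈ Icc (0 : ℝ) 1,
      HasDerivAt (fun x : ℝ ↦ (x : ℂ) * w x - (x : ℂ) ^ 2 * deriv w x) 0 x := by
    intro x hx
    have h1 := (hw x hx).differentiableAt.hasDerivAt
    have h2 := (hw x hx).deriv.differentiableAt.hasDerivAt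
    refine (((hidd x).mul h1).sub (((hidd x).pow 2).mul h2)).congr_deriv ?_
    rcases hx.1.eq_or_lt with rfl | hpos
    · simp [hw0]
    · have hxc : (x : ℂ) ≠ 0 := by exact_mod_cast hpos.ne'
      have h := hode x ⟨hpos, hx.2⟩
      field_simp at h
      simp
      linear_combination -h
  have hP : ∀ x ∈ Icc (0 : ℝ) 1, (x : ℂ) * w x - (x : ℂ) ^ 2 * deriv w x = 0 := by
    intro x hx
    simpa using constant_of_has_deriv_right_zero
      (fun y hy ↦ (hd y hy).continuousAt.continuousWithinAt)
      (fun y hy ↦ (hd y (Ico_subset_Icc_self hy)).hasDerivWithinAt) x hx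
  intro x hx
  rcases hx.1.eq_or_lt with rfl | hpos
  · exact hw0
  have hxc : (x : ℂ) ≠ 0 := by exact_mod_cast hpos.ne'
  have hq : ∀ y ∈ Icc x 1, HasDerivAt (fun y : ℝ ↦ w y / y) 0 y := by
    intro y hy
    have hy' : y ∈ Icc (0 : ℝ) 1 := ⟨hx.1.trans hy.1, hy.2⟩
    have hyc : (y : ℂ) ≠ 0 := by exact_mod_cast (hpos.trans_le hy.1).ne'
    refine ((hw y hy').differentiableAt.hasDerivAt.div (hidd y) hyc).congr_deriv ?_
    have h : (y : ℂ) * (w y - y * deriv w y) = 0 := by linear_combination hP y hy'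
    have h' := (mul_eq_zero.1 h).resolve_left hyc
    rw [div_eq_zero_iff]
    left
    linear_combination -h'
  have := constant_of_has_deriv_right_zero
    (fun y hy ↦ (hq y hy).continuousAt.continuousWithinAt)
    (fun y hy ↦ (hq y (Ico_subset_Icc_self hy)).hasDerivWithinAt) 1 ⟨hx.2, le_rfl⟩
  simpa [hw1, hxc, eq_comm] using this

/-- Existence and uniqueness for analytic forcing functions in the model
problem: for every `f` analytic on a neighbourhood of `[0,1]` there is a
function `u`, analytic on a neighbourhood of `[0,1]`, with `u(0) = u(1) = 0`
and `u'' + (1/x)u' − (1/x²)u = f` on `(0,1]`; it is unique on `[0,1]`. -/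
theorem model_problem_exists_unique_analytic
    (f : ℝ → ℂ) (hf : AnalyticOnNhd ℝ f (Set.Icc (0:ℝ) 1)) :
    ∃ u : ℝ → ℂ,
      (AnalyticOnNhd ℝ u (Set.Icc (0:ℝ) 1) ∧ u 0 = 0 ∧ u 1 = 0 ∧
        ∀ x ∈ Set.Ioc (0:ℝ) 1,
          deriv (deriv u) x + (1/(x:ℂ)) * deriv u x - (1/(x:ℂ)^2) * u x = f x) ∧
      ∀ v : ℝ → ℂ,
        (AnalyticOnNhd ℝ v (Set.Icc (0:ℝ) 1) ∧ v 0 = 0 ∧ v 1 = 0 ∧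
          ∀ x ∈ Set.Ioc (0:ℝ) 1,
            deriv (deriv v) x + (1/(x:ℂ)) * deriv v x - (1/(x:ℂ)^2) * v x = f x) →
        Set.EqOn v u (Set.Icc (0:ℝ) 1) := by
  obtain ⟨u, hu, hu0, hu1, hode⟩ := exists_analytic_solution hf
  refine ⟨u, ⟨hu, hu0, hu1, hode⟩, fun v ⟨hv, hv0, hv1, hvode⟩ ↦ ?_⟩
  have hsub : ∀ x ∈ Icc (0 : ℝ) 1, ∀ᶠ y in nhds x, deriv (v - u) y = deriv v y - deriv u y := by
    intro x hx
    filter_upwards [(hv x hx).eventually_analyticAt, (hu x hx).eventually_analyticAt]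
      with y hvy huy
    exact deriv_sub hvy.differentiableAt huy.differentiableAt
  have h := eqOn_zero_of_homogeneous (hv.sub hu) (by simp [hu0, hv0]) (by simp [hu1, hv1]) <| by
    intro x hx
    have hx' := Ioc_subset_Icc_self hx
    have h2 : deriv (deriv (v - u)) x = deriv (deriv v) x - deriv (deriv u) x := by
      rw [Filter.EventuallyEq.deriv_eq (hsub x hx')]
      exact deriv_sub (hv x hx').deriv.differentiableAt (hu x hx').deriv.differentiableAt
    rw [h2, (hsub x hx').self_of_nhds, Pi.sub_apply]
    linear_combination hvode x hx - hode x hx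
  exact fun x hx ↦ sub_eq_zero.1 (h hx)
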